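/- arXiv:1602.01196 — 3 statements merged into one kernel-verified Lean document; each statement's English description precedes it below -/
import Mathlib

section
/- Assume Randomization and Monotonicity (S(1) ≥ S(0) almost surely). Then the principal stratum proportions are identified by the observed intermediate-variable distributions: P(S(1)=1 and S(0)=1) = P(S=1 | Z=0), P(S(1)=0 and S(0)=0) = 1 − P(S=1 | Z=1), and P(S(1)=1 and S(0)=0) = P(S=1 | Z=1) − P(S=1 | Z=0). -/
open MeasureTheory ProbabilityTheory

/-- If `Y` is independent of `Z` and `S` agrees with `Y` on `{Z = z}`, then the conditional
distribution of `S` given `Z = z` is the distribution of `Y`. -/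
lemma cond_eq_measure_of_indepFun {Ω α β : Type*} [MeasurableSpace Ω]
    [MeasurableSpace α] [MeasurableSingletonClass α]
    [MeasurableSpace β] [MeasurableSingletonClass β]
    {μ : Measure Ω} [IsFiniteMeasure μ] {Z : Ω → α} {Y S : Ω → β} {z : α}
    (hZ : Measurable Z) (hind : IndepFun Z Y μ) (hz : μ {ω | Z ω = z} ≠ 0)
    (hS : ∀ ω, Z ω = z → S ω = Y ω) (y : β) :
    (μ[|{ω | Z ω = z}]) {ω | S ω = y} = μ {ω | Y ω = y} := by
  have hinter : {ω | Z ω = z} ∩ {ω | S ω = y} = {ω | Z ω = z} ∩ {ω | Y ω = y} := by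
    ext ω
    simp only [Set.mem_inter_iff, Set.mem_ofPred_eq]
    exact and_congr_right fun h => by rw [hS ω h]
  have hmul : μ ({ω | Z ω = z} ∩ {ω | Y ω = y}) = μ {ω | Z ω = z} * μ {ω | Y ω = y} :=
    hind.measure_inter_preimage_eq_mul {z} {y} (measurableSet_singleton z)
      (measurableSet_singleton y)
  have hmeas : MeasurableSet {ω | Z ω = z} := hZ (measurableSet_singleton z)
  rw [cond_apply hmeas, hinter, hmul, ← mul_assoc,
    ENNReal.inv_mul_cancel hz (measure_ne_top _ _), one_mul]

/-- Identification of the principal stratum proportions under Randomization and Monotonicity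
(Section 3.1): `π_{ss} = P(S=1 | Z=0)`, `π_{s̄s̄} = 1 − P(S=1 | Z=1)`, and
`π_{ss̄} = P(S=1 | Z=1) − P(S=1 | Z=0)`. -/
theorem proportions_monotonicity {Ω E : Type*}
    [mΩ : MeasurableSpace Ω] [StandardBorelSpace Ω] [mE : MeasurableSpace E]
    (μ : Measure Ω) [IsProbabilityMeasure μ]
    (Z S1 S0 : Ω → ℝ) (X : Ω → E)
    (hZ : Measurable Z) (hS1 : Measurable S1) (hS0 : Measurable S0) (hX : Measurable X)
    (hZbin : ∀ ω, Z ω = 0 ∨ Z ω = 1)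
    (hS1bin : ∀ ω, S1 ω = 0 ∨ S1 ω = 1)
    (hS0bin : ∀ ω, S0 ω = 0 ∨ S0 ω = 1)
    (S : Ω → ℝ)
    (hSdef : ∀ ω, S ω = Z ω * S1 ω + (1 - Z ω) * S0 ω)
    -- Randomization
    (hrand : IndepFun Z (fun ω => (S1 ω, S0 ω, X ω)) μ)
    (hZpos : 0 < μ {ω | Z ω = 1}) (hZlt : μ {ω | Z ω = 1} < 1)
    -- Monotonicity
    (hmono : ∀ᵐ ω ∂μ, S0 ω ≤ S1 ω) :
    (μ {ω | S1 ω = 1 ∧ S0 ω = 1}).toReal =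
        ((μ[|{ω | Z ω = 0}]) {ω | S ω = 1}).toReal ∧
      (μ {ω | S1 ω = 0 ∧ S0 ω = 0}).toReal =
        1 - ((μ[|{ω | Z ω = 1}]) {ω | S ω = 1}).toReal ∧
      (μ {ω | S1 ω = 1 ∧ S0 ω = 0}).toReal =
        ((μ[|{ω | Z ω = 1}]) {ω | S ω = 1}).toReal -
          ((μ[|{ω | Z ω = 0}]) {ω | S ω = 1}).toReal := by
  have hZ0 : μ {ω | Z ω = 0} ≠ 0 := by
    have hcompl : {ω | Z ω = 0} = {ω | Z ω = 1}ᶜ := by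
      ext ω
      rcases hZbin ω with h | h <;> simp [h]
    rw [hcompl]
    exact fun h => hZlt.ne ((prob_compl_eq_zero_iff (hZ (measurableSet_singleton 1))).mp h)
  have hcond1 : (μ[|{ω | Z ω = 1}]) {ω | S ω = 1} = μ {ω | S1 ω = 1} :=
    cond_eq_measure_of_indepFun hZ (hrand.comp measurable_id measurable_fst) hZpos.ne'
      (fun ω h => by simp [hSdef, h]) 1
  have hcond0 : (μ[|{ω | Z ω = 0}]) {ω | S ω = 1} = μ {ω | S0 ω = 1} :=
    cond_eq_measure_of_indepFun hZ (hrand.comp measurable_id measurable_snd.fst) hZ0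
      (fun ω h => by simp [hSdef, h]) 1
  have hss : μ {ω | S1 ω = 1 ∧ S0 ω = 1} = μ {ω | S0 ω = 1} := by
    refine measure_congr (Filter.eventuallyEq_set.mpr ?_)
    filter_upwards [hmono] with ω h
    rcases hS1bin ω with h1 | h1 <;> rcases hS0bin ω with h0 | h0 <;> simp_all
    norm_num at h
  have hnn : μ {ω | S1 ω = 0 ∧ S0 ω = 0} = μ {ω | S1 ω = 1}ᶜ := by
    refine measure_congr (Filter.eventuallyEq_set.mpr ?_)
    filter_upwards [hmono] with ω h
    rcases hS1bin ω with h1 | h1 <;> rcases hS0bin ω with h0 | h0 <;> simp_all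
    norm_num at h
  have hsplit : μ.real {ω | S1 ω = 1 ∧ S0 ω = 1} + μ.real {ω | S1 ω = 1 ∧ S0 ω = 0} =
      μ.real {ω | S1 ω = 1} := by
    rw [← measureReal_inter_add_sdiff (s := {ω | S1 ω = 1}) (hS0 (measurableSet_singleton 1))]
    congr 2
    ext ω
    rcases hS0bin ω with h0 | h0 <;> simp [h0]
  have hcompl : μ.real {ω | S1 ω = 1}ᶜ = 1 - μ.real {ω | S1 ω = 1} :=
    probReal_compl_eq_one_sub (hS1 (measurableSet_singleton 1))
  simp only [measureReal_def, hss] at hsplit hcompl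
  rw [hcond1, hcond0, hss, hnn]
  exact ⟨rfl, hcompl, by linarith⟩
end

section
/- On a probability space (Ω, 𝓕, P), let Y : Ω → ℝ, let W : Ω → F and X : Ω → E be random variables into measurable spaces F and E, and let Z : Ω → {0,1} be a random variable independent of the triple (Y, W, X). Suppose Y and W are conditionally independent given σ(X), and let B ⊆ F be a measurable set with P({Z=1} ∩ {W ∈ B}) > 0. Then under the conditional probability measure P(· | {Z=1} ∩ {W ∈ B}), Y and W are conditionally independent given σ(X). -/
open MeasureTheory ProbabilityTheory

/-- If `f` and `h` have the same integral over `C ∩ A` for every `C` in `m`, then they have the same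
conditional expectation given `m` under the conditional measure `μ[|A]`. -/
theorem condExp_cond_ae_eq_of_setIntegral_inter_eq {Ω : Type*} {m mΩ : MeasurableSpace Ω}
    {μ : Measure Ω} [IsFiniteMeasure μ] (hm : m ≤ mΩ) {A : Set Ω}
    {f h : Ω → ℝ} (hf : Integrable f μ) (hh : Integrable h μ)
    (hfh : ∀ C, MeasurableSet[m] C → ∫ x in C ∩ A, f x ∂μ = ∫ x in C ∩ A, h x ∂μ) :
    (μ[|A])[f | m] =ᵐ[μ[|A]] (μ[|A])[h | m] := by
  have hint : ∀ {k : Ω → ℝ}, Integrable k μ → Integrable k (μ[|A]) := by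
    intro k hk
    by_cases hA : μ A = 0
    · simp [cond_eq_zero_of_meas_eq_zero hA]
    · exact hk.restrict.smul_measure (ENNReal.inv_ne_top.2 hA)
  refine ae_eq_condExp_of_forall_setIntegral_eq hm (hint hh)
    (fun _ _ _ ↦ integrable_condExp.integrableOn) (fun C hC _ ↦ ?_)
    stronglyMeasurable_condExp.aestronglyMeasurable
  rw [setIntegral_condExp hm (hint hf) hC]
  simp only [ProbabilityTheory.cond, Measure.restrict_smul, integral_smul_measure,
    Measure.restrict_restrict (hm C hC), hfh C hC]

theorem ProbabilityTheory.Indep.setIntegral_inter_eq_mul {Ω : Type*}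
    {m₁ m₂ mΩ : MeasurableSpace Ω} {μ : Measure Ω} [IsFiniteMeasure μ] (hind : Indep m₁ m₂ μ)
    (hm₁ : m₁ ≤ mΩ) (hm₂ : m₂ ≤ mΩ) {A D : Set Ω} (hA : MeasurableSet[m₁] A)
    (hD : MeasurableSet[m₂] D) {f : Ω → ℝ} (hf : Measurable[m₂] f)
    (hfi : Integrable f μ) :
    ∫ x in D ∩ A, f x ∂μ = μ.real A * ∫ x in D, f x ∂μ := by
  have hint : Integrable (D.indicator f) μ := hfi.indicator (hm₂ D hD)
  have hconst : μ[D.indicator f | m₁] =ᵐ[μ] fun _ ↦ ∫ x, D.indicator f x ∂μ :=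
    condExp_indep_eq hm₂ hm₁ (hf.indicator hD).stronglyMeasurable hind.symm
  rw [Set.inter_comm, ← setIntegral_indicator (hm₂ D hD), ← integral_indicator (hm₂ D hD),
    ← setIntegral_condExp hm₁ hint hA, integral_congr_ae (ae_restrict_of_ae hconst),
    setIntegral_const, smul_eq_mul]

theorem ProbabilityTheory.CondIndepFun.setIntegral_condExp_inter_preimage {Ω β γ : Type*}
    {m mΩ : MeasurableSpace Ω} [StandardBorelSpace Ω] [MeasurableSpace β] [MeasurableSpace γ]
    {μ : Measure Ω} [IsFiniteMeasure μ] {hm : m ≤ mΩ} {Y : Ω → β} {W : Ω → γ}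
    (hCI : CondIndepFun m hm Y W μ) (hY : Measurable Y) (hW : Measurable W)
    {s : Set β} (hs : MeasurableSet s) {t : Set γ} (ht : MeasurableSet t)
    {C : Set Ω} (hC : MeasurableSet[m] C) :
    ∫ x in C ∩ W ⁻¹' t, (μ⟦Y ⁻¹' s | m⟧) x ∂μ
      = ∫ x in C ∩ W ⁻¹' t, (Y ⁻¹' s).indicator (fun _ ↦ (1 : ℝ)) x ∂μ := by
  have hone : ∀ {D : Set Ω}, MeasurableSet D → Integrable (D.indicator fun _ ↦ (1 : ℝ)) μ :=
    fun hD ↦ (integrable_const 1).indicator hD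
  have hmul : (μ⟦Y ⁻¹' s | m⟧) * (W ⁻¹' t).indicator (fun _ ↦ (1 : ℝ))
      = (W ⁻¹' t).indicator (μ⟦Y ⁻¹' s | m⟧) := by
    ext x
    by_cases hx : x ∈ W ⁻¹' t <;> simp [hx]
  have hint : Integrable ((μ⟦Y ⁻¹' s | m⟧) * (W ⁻¹' t).indicator (fun _ ↦ (1 : ℝ))) μ :=
    hmul ▸ integrable_condExp.indicator (hW ht)
  have hpull : μ[(μ⟦Y ⁻¹' s | m⟧) * (W ⁻¹' t).indicator (fun _ ↦ (1 : ℝ)) | m]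
      =ᵐ[μ] μ⟦Y ⁻¹' s ∩ W ⁻¹' t | m⟧ :=
    (condExp_mul_of_stronglyMeasurable_left stronglyMeasurable_condExp hint (hone (hW ht))).trans
      ((condIndepFun_iff_condExp_inter_preimage_eq_mul hY hW).1 hCI s t hs ht).symm
  calc
    _ = ∫ x in C, ((μ⟦Y ⁻¹' s | m⟧) * (W ⁻¹' t).indicator (fun _ ↦ (1 : ℝ))) x ∂μ := by
      rw [hmul, setIntegral_indicator (hW ht)]
    _ = ∫ x in C, (Y ⁻¹' s ∩ W ⁻¹' t).indicator (fun _ ↦ (1 : ℝ)) x ∂μ := by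
      rw [← setIntegral_condExp hm hint hC,
        ← setIntegral_condExp hm (hone ((hY hs).inter (hW ht))) hC]
      exact integral_congr_ae (ae_restrict_of_ae hpull)
    _ = _ := by
      rw [← setIntegral_indicator (hW ht), Set.indicator_indicator, Set.inter_comm]

/-- Lemma A.6 (general form): if `Z` is independent of `(Y, W, X)` and `Y ⫫ W | σ(X)`, then
conditioning on the event `{Z=1} ∩ {W ∈ B}` (of positive probability) preserves the conditional
independence `Y ⫫ W | σ(X)`. -/
theorem condIndep_preserved_by_conditioning {Ω E F : Type*}
    [mΩ : MeasurableSpace Ω] [StandardBorelSpace Ω]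
    [mE : MeasurableSpace E] [mF : MeasurableSpace F]
    (μ : Measure Ω) [IsProbabilityMeasure μ]
    (Y : Ω → ℝ) (W : Ω → F) (X : Ω → E) (Z : Ω → ℝ)
    (hY : Measurable Y) (hW : Measurable W) (hX : Measurable X) (hZ : Measurable Z)
    (hZbin : ∀ ω, Z ω = 0 ∨ Z ω = 1)
    (hindep : IndepFun Z (fun ω => (Y ω, W ω, X ω)) μ)
    (hXle : MeasurableSpace.comap X mE ≤ mΩ)
    (hCI : CondIndepFun (MeasurableSpace.comap X mE) hXle Y W μ)
    (B : Set F) (hB : MeasurableSet B)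
    (hpos : 0 < μ ({ω | Z ω = 1} ∩ {ω | W ω ∈ B})) :
    letI : IsProbabilityMeasure (μ[|{ω | Z ω = 1} ∩ {ω | W ω ∈ B}]) :=
      cond_isProbabilityMeasure hpos.ne'
    CondIndepFun (MeasurableSpace.comap X mE) hXle Y W
      (μ[|{ω | Z ω = 1} ∩ {ω | W ω ∈ B}]) := by
  have hone : ∀ {ν : Measure Ω} [IsFiniteMeasure ν] {D : Set Ω}, MeasurableSet D →
      Integrable (D.indicator fun _ ↦ (1 : ℝ)) ν :=
    fun hD ↦ (integrable_const 1).indicator hD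
  let m := MeasurableSpace.comap X mE
  let mT := MeasurableSpace.comap (fun ω ↦ (Y ω, W ω, X ω)) inferInstance
  have hT : mT ≤ mΩ := (hY.prodMk (hW.prodMk hX)).comap_le
  have hTm : Measurable[mT] fun ω ↦ (Y ω, W ω, X ω) := comap_measurable _
  have hYT : Measurable[mT] Y := hTm.fst
  have hWT : Measurable[mT] W := hTm.snd.fst
  have hXT : m ≤ mT := hTm.snd.snd.comap_le
  have hZA : MeasurableSet[MeasurableSpace.comap Z inferInstance] {ω | Z ω = 1} :=
    ⟨{1}, measurableSet_singleton 1, rfl⟩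
  set A := {ω | Z ω = 1} ∩ {ω | W ω ∈ B} with hAdef
  rw [condIndepFun_iff_condExp_inter_preimage_eq_mul hY hW]
  intro s t hs ht
  set g := μ⟦Y ⁻¹' s | m⟧
  have hgm : StronglyMeasurable[m] g := stronglyMeasurable_condExp
  have hmul : ∀ V : Set Ω, g * V.indicator (fun _ ↦ (1 : ℝ)) = V.indicator g := by
    intro V
    ext x
    by_cases hx : x ∈ V <;> simp [hx]
  have hgA : Integrable g (μ[|A]) :=
    (integrable_condExp (m := m) (μ := μ)).restrict.smul_measure (ENNReal.inv_ne_top.2 hpos.ne')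
  have hpull : ∀ u, MeasurableSet u → (μ[|A])⟦Y ⁻¹' s ∩ W ⁻¹' u | m⟧
      =ᵐ[μ[|A]] g * (μ[|A])⟦W ⁻¹' u | m⟧ := by
    intro u hu
    have hint : Integrable (g * (W ⁻¹' u).indicator (fun _ ↦ (1 : ℝ))) (μ[|A]) :=
      hmul _ ▸ hgA.indicator (hW hu)
    refine .trans ?_ (condExp_mul_of_stronglyMeasurable_left hgm hint (hone (hW hu)))
    refine condExp_cond_ae_eq_of_setIntegral_inter_eq hXle (hone ((hY hs).inter (hW hu)))
      (hmul _ ▸ integrable_condExp.indicator (hW hu)) fun C hC ↦ ?_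
    have hset : C ∩ A ∩ W ⁻¹' u = C ∩ W ⁻¹' (u ∩ B) ∩ {ω | Z ω = 1} := by
      ext ω
      simp only [hAdef, Set.mem_inter_iff, Set.mem_preimage, Set.mem_ofPred_eq]
      tauto
    have hD : MeasurableSet[mT] (C ∩ W ⁻¹' (u ∩ B)) := (hXT C hC).inter (hWT (hu.inter hB))
    rw [hmul, Set.inter_comm (Y ⁻¹' s), ← Set.indicator_indicator,
      setIntegral_indicator (hW hu), setIntegral_indicator (hW hu), hset,
      Indep.setIntegral_inter_eq_mul hindep hZ.comap_le hT hZA hD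
        (measurable_const.indicator (hYT hs))
        (hone (hY hs)),
      Indep.setIntegral_inter_eq_mul hindep hZ.comap_le hT hZA hD (hgm.mono hXT).measurable
        integrable_condExp,
      hCI.setIntegral_condExp_inter_preimage hY hW hs (hu.inter hB) hC]
  have hYs : (μ[|A])⟦Y ⁻¹' s | m⟧ =ᵐ[μ[|A]] g := by
    have hu := hpull Set.univ .univ
    simp only [Set.preimage_univ, Set.inter_univ, Set.indicator_univ] at hu
    rwa [condExp_const hXle, show (fun _ : Ω ↦ (1 : ℝ)) = 1 from rfl, mul_one] at hu
  filter_upwards [hpull t ht, hYs] with ω h₁ h₂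
  rw [h₁, h₂, Pi.mul_apply]
end

section
/- Let p₀, p₁, ξ and π_{ss}, π_{ss̄}, π_{s̄s}, π_{s̄s̄} be real numbers with π_{ss}, π_{ss̄}, π_{s̄s}, π_{s̄s̄} ≥ 0 and 0 ≤ ξ < 1, satisfying the four equations π_{ss} + π_{ss̄} = p₁, π_{ss} + π_{s̄s} = p₀, π_{ss} + π_{ss̄} + π_{s̄s} + π_{s̄s̄} = 1, and π_{s̄s} = ξ·π_{ss̄}. Then π_{ss̄} = (p₁ − p₀)/(1 − ξ), π_{s̄s̄} = 1 − p₀ − (p₁ − p₀)/(1 − ξ), π_{ss} = p₁ − (p₁ − p₀)/(1 − ξ), and π_{s̄s} = ξ·(p₁ − p₀)/(1 − ξ). Moreover, if p₁ ≥ p₀, p₁ > 0, and p₀ < 1, then ξ ≤ 1 − (p₁ − p₀)/min(p₁, 1 − p₀) ≤ 1. -/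
/-- Proposition 5: without Monotonicity, for a fixed sensitivity parameter `ξ`, the four
principal stratum proportions are identified from `p₁`, `p₀` and `ξ`, and the observed data
bound the sensitivity parameter: `ξ ≤ 1 − (p₁ − p₀)/min(p₁, 1 − p₀) ≤ 1`. -/
theorem proportions_without_monotonicity
    (p0 p1 ξ πss πssb πsbs πsbsb : ℝ)
    (hπss : 0 ≤ πss) (hπssb : 0 ≤ πssb) (hπsbs : 0 ≤ πsbs) (hπsbsb : 0 ≤ πsbsb)
    (hξ0 : 0 ≤ ξ) (hξ1 : ξ < 1)
    (h1 : πss + πssb = p1)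
    (h2 : πss + πsbs = p0)
    (h3 : πss + πssb + πsbs + πsbsb = 1)
    (h4 : πsbs = ξ * πssb) :
    πssb = (p1 - p0) / (1 - ξ) ∧
    πsbsb = 1 - p0 - (p1 - p0) / (1 - ξ) ∧
    πss = p1 - (p1 - p0) / (1 - ξ) ∧
    πsbs = ξ * (p1 - p0) / (1 - ξ) ∧
    (p0 ≤ p1 → 0 < p1 → p0 < 1 →
      ξ ≤ 1 - (p1 - p0) / min p1 (1 - p0) ∧
        1 - (p1 - p0) / min p1 (1 - p0) ≤ 1) := by
  have hξ : 0 < 1 - ξ := sub_pos.mpr hξ1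
  have hdiff : p1 - p0 = (1 - ξ) * πssb := by linear_combination -h1 + h2 - h4
  have hcompl : (p1 - p0) / (1 - ξ) = πssb := by
    rw [hdiff, mul_div_cancel_left₀ _ hξ.ne']
  refine ⟨hcompl.symm, ?_, ?_, ?_, fun hle hp1 hp0 => ?_⟩
  · rw [hcompl]
    linarith
  · rw [hcompl]
    linarith
  · rw [mul_div_assoc, hcompl, h4]
  · have hmin : 0 < min p1 (1 - p0) := lt_min hp1 (sub_pos.mpr hp0)
    have hπ : πssb ≤ min p1 (1 - p0) := le_min (by linarith) (by linarith)
    have hbound : (p1 - p0) / min p1 (1 - p0) ≤ 1 - ξ := by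
      rw [div_le_iff₀ hmin, hdiff]
      exact mul_le_mul_of_nonneg_left hπ hξ.le
    have hnonneg : 0 ≤ (p1 - p0) / min p1 (1 - p0) :=
      div_nonneg (sub_nonneg.mpr hle) hmin.le
    exact ⟨by linarith, by linarith⟩
end
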